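/- There is a strict 2-category (bicategory) B_n with a single object, whose 1-morphisms are the permutations of Fin n with composition given by multiplication in the symmetric group and identity 1-morphism the identity permutation, whose 2-morphisms from a permutation π to a permutation σ are the propagating setoids r on Fin n ⊕ Fin n with G(π) ≤ r and G(σ) ≤ r, with vertical composition of 2-morphisms given by the join ⊔ of setoids, identity 2-morphism on π given by G(π), and horizontal composition of 2-morphisms given by the partition product of setoids. -/

import Mathlib

/-- The setoid on `Fin n ⊕ Fin n` generated by the pairs `inl x ≈ inr (σ x)`,
for `σ` a permutation of `Fin n`. -/
def permSetoid {n : ℕ} (σ : Equiv.Perm (Fin n)) : Setoid (Fin n ⊕ Fin n) :=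
  Relation.EqvGen.setoid (fun a b => ∃ x : Fin n, a = Sum.inl x ∧ b = Sum.inr (σ x))

/-- A setoid on `Fin n ⊕ Fin n` is propagating if every equivalence class contains
an element of the left summand and an element of the right summand. -/
def Propagating {n : ℕ} (r : Setoid (Fin n ⊕ Fin n)) : Prop :=
  ∀ a : Fin n ⊕ Fin n,
    (∃ x : Fin n, r a (Sum.inl x)) ∧ (∃ y : Fin n, r a (Sum.inr y))

/-- The setoid on `T` induced (generated) by the image of a setoid `r` on `X`
along a map `f : X → T`. -/
def inducedSetoid {X T : Type*} (f : X → T) (r : Setoid X) : Setoid T :=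
  Relation.EqvGen.setoid (fun t u => ∃ a b : X, r a b ∧ t = f a ∧ u = f b)

/-- The partition product `r · s` of two setoids on `Fin n ⊕ Fin n`, defined via the
three-layer set `Fin n ⊕ (Fin n ⊕ Fin n)` (layer 1 = `inl`, layer 2 = `inr ∘ inl`,
layer 3 = `inr ∘ inr`): embed `s` identifying layers 1 and 2, embed `r` identifying
layers 2 and 3, take the join, and relate two elements of `Fin n ⊕ Fin n` iff their
images under `inl ↦ layer 1`, `inr ↦ layer 3` are related by this join. -/
def partitionProd {n : ℕ} (r s : Setoid (Fin n ⊕ Fin n)) : Setoid (Fin n ⊕ Fin n) :=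
  Setoid.comap
    (Sum.elim (fun x => Sum.inl x) (fun y => Sum.inr (Sum.inr y)))
    (inducedSetoid (Sum.elim (fun x => Sum.inr (Sum.inl x)) (fun y => Sum.inr (Sum.inr y))) r ⊔
      inducedSetoid (Sum.elim (fun x => Sum.inl x) (fun y => Sum.inr (Sum.inl y))) s)

/-- The axioms of a strict 2-category (bicategory) with a single object, whose
1-morphisms form the type `M` with composition `mul` and identity `one`, and whose
2-morphisms from `a : M` to `b : M` are the elements `φ` of the ambient type `Two`
satisfying `Mor2 a b φ`, with vertical composition `vcomp`, identity 2-morphisms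
`id2` and horizontal composition `hcomp`. -/
structure IsStrictTwoCategoryWithOneObject (M : Type*) (mul : M → M → M) (one : M)
    (Two : Type*) (Mor2 : M → M → Two → Prop)
    (vcomp : Two → Two → Two) (id2 : M → Two) (hcomp : Two → Two → Two) : Prop where
  /-- composition of 1-morphisms is associative -/
  mul_assoc : ∀ a b c, mul (mul a b) c = mul a (mul b c)
  /-- `one` is a left identity 1-morphism -/
  one_mul : ∀ a, mul one a = a
  /-- `one` is a right identity 1-morphism -/
  mul_one : ∀ a, mul a one = a
  /-- vertical composition is well defined -/
  vcomp_mem : ∀ {a b c : M} {α β : Two}, Mor2 a b α → Mor2 b c β → Mor2 a c (vcomp β α)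
  /-- vertical composition is associative -/
  vcomp_assoc : ∀ {a b c d : M} {α β γ : Two}, Mor2 a b α → Mor2 b c β → Mor2 c d γ →
    vcomp (vcomp γ β) α = vcomp γ (vcomp β α)
  /-- the identity 2-morphism on `a` is a 2-morphism from `a` to `a` -/
  id2_mem : ∀ a, Mor2 a a (id2 a)
  /-- right vertical unitality -/
  vcomp_id2 : ∀ {a b : M} {α : Two}, Mor2 a b α → vcomp α (id2 a) = α
  /-- left vertical unitality -/
  id2_vcomp : ∀ {a b : M} {α : Two}, Mor2 a b α → vcomp (id2 b) α = α
  /-- horizontal composition is well defined -/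
  hcomp_mem : ∀ {a b c d : M} {α β : Two}, Mor2 a b α → Mor2 c d β →
    Mor2 (mul c a) (mul d b) (hcomp β α)
  /-- horizontal composition is associative -/
  hcomp_assoc : ∀ {a b c d e f : M} {α β γ : Two}, Mor2 a b α → Mor2 c d β → Mor2 e f γ →
    hcomp (hcomp γ β) α = hcomp γ (hcomp β α)
  /-- right horizontal unitality -/
  hcomp_id2_one : ∀ {a b : M} {α : Two}, Mor2 a b α → hcomp α (id2 one) = α
  /-- left horizontal unitality -/
  id2_one_hcomp : ∀ {a b : M} {α : Two}, Mor2 a b α → hcomp (id2 one) α = α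
  /-- horizontal composition of identity 2-morphisms is an identity 2-morphism -/
  id2_hcomp_id2 : ∀ a b, hcomp (id2 a) (id2 b) = id2 (mul a b)
  /-- the interchange law -/
  interchange : ∀ {a b c a' b' c' : M} {α β γ δ : Two}, Mor2 a b α → Mor2 a' b' β →
    Mor2 b c γ → Mor2 b' c' δ →
    vcomp (hcomp δ γ) (hcomp β α) = hcomp (vcomp δ β) (vcomp γ α)

namespace Setoid

theorem comap_sup_of_surjective {X Y : Type*} {f : X → Y} (hf : Function.Surjective f)
    (r s : Setoid Y) : comap f (r ⊔ s) = comap f r ⊔ comap f s := by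
  apply le_antisymm
  · have key : r ⊔ s ≤ comap (Function.surjInv hf) (comap f r ⊔ comap f s) := by
      refine sup_le (fun x y h => ?_) (fun x y h => ?_)
      · refine (le_sup_left : comap f r ≤ comap f r ⊔ comap f s) ?_
        change r (f _) (f _)
        rwa [Function.surjInv_eq hf, Function.surjInv_eq hf]
      · refine (le_sup_right : comap f s ≤ comap f r ⊔ comap f s) ?_
        change s (f _) (f _)
        rwa [Function.surjInv_eq hf, Function.surjInv_eq hf]
    have section_rel (x : X) :
        (comap f r ⊔ comap f s) x (Function.surjInv hf (f x)) := by
      refine (le_sup_left : comap f r ≤ comap f r ⊔ comap f s) ?_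
      change r (f _) (f _)
      rw [Function.surjInv_eq hf]
    intro x y h
    exact Setoid.trans' _ (section_rel x) (Setoid.trans' _ (key h) (Setoid.symm' _ (section_rel y)))
  · exact sup_le (fun _ _ h => (le_sup_left : r ≤ r ⊔ s) h)
      (fun _ _ h => (le_sup_right : s ≤ r ⊔ s) h)

theorem comap_comap {X Y Z : Type*} (f : X → Y) (g : Y → Z) (r : Setoid Z) :
    comap f (comap g r) = comap (g ∘ f) r := rfl

end Setoid

section

variable {n : ℕ} {π σ τ : Equiv.Perm (Fin n)} {r s t : Setoid (Fin n ⊕ Fin n)}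

theorem permSetoid_le_iff : permSetoid π ≤ r ↔ ∀ x, r (Sum.inl x) (Sum.inr (π x)) := by
  refine ⟨fun h x => h (Relation.EqvGen.rel _ _ ⟨x, rfl, rfl⟩), fun h => ?_⟩
  refine Setoid.eqvGen_le ?_
  rintro _ _ ⟨x, rfl, rfl⟩
  exact h x

theorem propagating_of_permSetoid_le (h : permSetoid π ≤ r) : Propagating r := by
  rw [permSetoid_le_iff] at h
  rintro (x | y)
  · exact ⟨⟨x, Setoid.refl' r _⟩, ⟨π x, h x⟩⟩
  · exact ⟨⟨π.symm y, Setoid.symm' r (by simpa using h (π.symm y))⟩, ⟨y, Setoid.refl' r _⟩⟩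

theorem comap_elim_comap_inr (h : permSetoid π ≤ r) :
    Setoid.comap (Sum.elim π id) (Setoid.comap Sum.inr r) = r := by
  rw [permSetoid_le_iff] at h
  have rel (a : Fin n ⊕ Fin n) : r a (Sum.inr (Sum.elim π id a)) := by
    rcases a with x | y
    · exact h x
    · exact Setoid.refl' r _
  exact Setoid.ext fun a b =>
    ⟨fun hab => Setoid.trans' r (rel a) (Setoid.trans' r hab (Setoid.symm' r (rel b))),
      fun hab => Setoid.trans' r (Setoid.symm' r (rel a)) (Setoid.trans' r hab (rel b))⟩

theorem comap_inl_eq (h : permSetoid π ≤ r) :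
    Setoid.comap Sum.inl r = Setoid.comap π (Setoid.comap Sum.inr r) := by
  conv_lhs => rw [← comap_elim_comap_inr h]
  rfl

theorem comap_elim_comap_inl (h : permSetoid π ≤ r) :
    Setoid.comap (Sum.elim id π.symm) (Setoid.comap Sum.inl r) = r := by
  conv_rhs => rw [← comap_elim_comap_inr h]
  rw [comap_inl_eq h, Setoid.comap_comap]
  congr 1
  ext (x | y) <;> simp

theorem surjective_elim_id_right (f : Fin n → Fin n) : Function.Surjective (Sum.elim f id) :=
  fun y => ⟨Sum.inr y, rfl⟩

theorem surjective_elim_perm (π : Equiv.Perm (Fin n)) (f : Fin n → Fin n) :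
    Function.Surjective (Sum.elim π f) :=
  fun y => ⟨Sum.inl (π.symm y), π.apply_symm_apply y⟩

theorem comap_inr_sup (hr : permSetoid π ≤ r) (hs : permSetoid π ≤ s) :
    Setoid.comap Sum.inr (r ⊔ s) = Setoid.comap Sum.inr r ⊔ Setoid.comap Sum.inr s := by
  conv_lhs => rw [← comap_elim_comap_inr hr, ← comap_elim_comap_inr hs,
    ← Setoid.comap_sup_of_surjective (surjective_elim_id_right π)]
  rfl

theorem comap_inl_sup (hr : permSetoid π ≤ r) (hs : permSetoid π ≤ s) :
    Setoid.comap Sum.inl (r ⊔ s) = Setoid.comap Sum.inl r ⊔ Setoid.comap Sum.inl s := by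
  rw [comap_inl_eq (le_sup_of_le_left hr), comap_inr_sup hr hs,
    Setoid.comap_sup_of_surjective π.surjective, ← comap_inl_eq hr, ← comap_inl_eq hs]

theorem comap_inr_permSetoid (π : Equiv.Perm (Fin n)) :
    Setoid.comap Sum.inr (permSetoid π) = ⊥ := by
  have h : permSetoid π ≤ Setoid.comap (Sum.elim π id) ⊥ :=
    permSetoid_le_iff.2 fun _ => rfl
  exact le_bot_iff.1 fun _ _ hxy => h hxy

theorem comap_inl_permSetoid (π : Equiv.Perm (Fin n)) :
    Setoid.comap Sum.inl (permSetoid π) = ⊥ := by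
  rw [comap_inl_eq le_rfl, comap_inr_permSetoid]
  exact le_bot_iff.1 fun _ _ h => π.injective h

theorem permSetoid_eq_comap_bot (π : Equiv.Perm (Fin n)) :
    permSetoid π = Setoid.comap (Sum.elim π id) ⊥ := by
  rw [← comap_inr_permSetoid π, comap_elim_comap_inr le_rfl]

/-- The partition product of setoids lying above permutation setoids is computed on the
middle layer. -/
theorem partitionProd_eq (hr : permSetoid σ ≤ r) (hs : permSetoid π ≤ s) :
    partitionProd r s = Setoid.comap (Sum.elim π σ.symm)
      (Setoid.comap Sum.inr s ⊔ Setoid.comap Sum.inl r) := by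
  let upper : Fin n ⊕ Fin n → Fin n ⊕ (Fin n ⊕ Fin n) :=
    Sum.elim (fun x => Sum.inr (Sum.inl x)) (fun y => Sum.inr (Sum.inr y))
  let lower : Fin n ⊕ Fin n → Fin n ⊕ (Fin n ⊕ Fin n) :=
    Sum.elim (fun x => Sum.inl x) (fun y => Sum.inr (Sum.inl y))
  let m : Fin n ⊕ (Fin n ⊕ Fin n) → Fin n := Sum.elim π (Sum.elim id σ.symm)
  let F : Setoid (Fin n) := Setoid.comap Sum.inr s ⊔ Setoid.comap Sum.inl r
  let J := inducedSetoid upper r ⊔ inducedSetoid lower s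
  have upper_rel {a b} (h : r a b) : J (upper a) (upper b) :=
    (le_sup_left : _ ≤ J) (Relation.EqvGen.rel _ _ ⟨a, b, h, rfl, rfl⟩)
  have lower_rel {a b} (h : s a b) : J (lower a) (lower b) :=
    (le_sup_right : _ ≤ J) (Relation.EqvGen.rel _ _ ⟨a, b, h, rfl, rfl⟩)
  have J_le : J ≤ Setoid.comap m F := by
    refine sup_le (Setoid.eqvGen_le ?_) (Setoid.eqvGen_le ?_)
    · rintro _ _ ⟨a, b, h, rfl, rfl⟩
      refine (le_sup_right : _ ≤ F) ?_
      rw [← comap_elim_comap_inl hr] at h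
      rcases a with a | a <;> rcases b with b | b <;> exact h
    · rintro _ _ ⟨a, b, h, rfl, rfl⟩
      refine (le_sup_left : _ ≤ F) ?_
      rw [← comap_elim_comap_inr hs] at h
      rcases a with a | a <;> rcases b with b | b <;> exact h
  have F_le : F ≤ Setoid.comap (fun x => Sum.inr (Sum.inl x)) J :=
    sup_le (fun x y h => lower_rel (a := Sum.inr x) (b := Sum.inr y) h)
      (fun x y h => upper_rel (a := Sum.inl x) (b := Sum.inl y) h)
  rw [permSetoid_le_iff] at hr hs
  have middle_rel (a) : J a (Sum.inr (Sum.inl (m a))) := by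
    rcases a with x | y | z
    · exact lower_rel (hs x)
    · exact Setoid.refl' J _
    · have h := hr (σ.symm z)
      rw [Equiv.apply_symm_apply] at h
      exact Setoid.symm' J (upper_rel h)
  have J_eq : J = Setoid.comap m F := le_antisymm J_le fun a b h =>
    Setoid.trans' J (middle_rel a) (Setoid.trans' J (F_le h) (Setoid.symm' J (middle_rel b)))
  change Setoid.comap _ J = _
  rw [J_eq, Setoid.comap_comap]
  congr 1
  ext (x | y) <;> rfl

theorem permSetoid_mul_le_partitionProd (hr : permSetoid σ ≤ r) (hs : permSetoid π ≤ s) :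
    permSetoid (σ * π) ≤ partitionProd r s := by
  rw [partitionProd_eq hr hs, permSetoid_le_iff]
  intro x
  simp [Setoid.comap_rel]

theorem partitionProd_assoc (hr : permSetoid π ≤ r) (hs : permSetoid σ ≤ s)
    (ht : permSetoid τ ≤ t) :
    partitionProd (partitionProd t s) r = partitionProd t (partitionProd s r) := by
  rw [partitionProd_eq (permSetoid_mul_le_partitionProd ht hs) hr,
    partitionProd_eq ht (permSetoid_mul_le_partitionProd hs hr),
    partitionProd_eq ht hs, partitionProd_eq hs hr]
  change Setoid.comap _ (Setoid.comap Sum.inr r ⊔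
      Setoid.comap σ (Setoid.comap Sum.inr s ⊔ Setoid.comap Sum.inl t)) =
    Setoid.comap _ (Setoid.comap σ.symm (Setoid.comap Sum.inr r ⊔ Setoid.comap Sum.inl s) ⊔
      Setoid.comap Sum.inl t)
  have comap_symm : Setoid.comap σ
      (Setoid.comap σ.symm (Setoid.comap Sum.inr r ⊔ Setoid.comap Sum.inl s)) =
      Setoid.comap Sum.inr r ⊔ Setoid.comap Sum.inl s := by
    rw [Setoid.comap_comap, Equiv.symm_comp_self]
    rfl
  have middle_eq : Setoid.comap Sum.inr r ⊔
        Setoid.comap σ (Setoid.comap Sum.inr s ⊔ Setoid.comap Sum.inl t) =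
      Setoid.comap σ (Setoid.comap σ.symm (Setoid.comap Sum.inr r ⊔ Setoid.comap Sum.inl s) ⊔
        Setoid.comap Sum.inl t) := by
    rw [Setoid.comap_sup_of_surjective σ.surjective, Setoid.comap_sup_of_surjective σ.surjective,
      comap_symm, ← comap_inl_eq hs, sup_assoc]
  rw [middle_eq, Setoid.comap_comap]
  congr 1
  ext (x | y) <;> simp [← Equiv.Perm.inv_def]

theorem partitionProd_sup {r' s' : Setoid (Fin n ⊕ Fin n)}
    (hr : permSetoid σ ≤ r) (hr' : permSetoid σ ≤ r')
    (hs : permSetoid π ≤ s) (hs' : permSetoid π ≤ s') :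
    partitionProd r s ⊔ partitionProd r' s' = partitionProd (r ⊔ r') (s ⊔ s') := by
  rw [partitionProd_eq hr hs, partitionProd_eq hr' hs',
    partitionProd_eq (le_sup_of_le_left hr) (le_sup_of_le_left hs),
    comap_inr_sup hs hs', comap_inl_sup hr hr',
    ← Setoid.comap_sup_of_surjective (surjective_elim_perm π _), sup_sup_sup_comm]

theorem partitionProd_permSetoid_one (hr : permSetoid π ≤ r) :
    partitionProd r (permSetoid 1) = r := by
  rw [partitionProd_eq hr le_rfl, comap_inr_permSetoid, bot_sup_eq]
  exact comap_elim_comap_inl hr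

theorem permSetoid_one_partitionProd (hr : permSetoid π ≤ r) :
    partitionProd (permSetoid 1) r = r := by
  rw [partitionProd_eq le_rfl hr, comap_inl_permSetoid, sup_bot_eq]
  exact comap_elim_comap_inr hr

theorem partitionProd_permSetoid (σ π : Equiv.Perm (Fin n)) :
    partitionProd (permSetoid σ) (permSetoid π) = permSetoid (σ * π) := by
  refine le_antisymm ?_ (permSetoid_mul_le_partitionProd le_rfl le_rfl)
  rw [partitionProd_eq le_rfl le_rfl, comap_inl_permSetoid, comap_inr_permSetoid, sup_bot_eq,
    permSetoid_eq_comap_bot (σ * π)]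
  intro a b h
  have hab := congrArg σ (show Sum.elim π σ.symm a = Sum.elim π σ.symm b from h)
  change Sum.elim (σ * π) id a = Sum.elim (σ * π) id b
  rcases a with a | a <;> rcases b with b | b <;> simpa using hab

end

/-- There is a strict 2-category `B_n` with a single object whose 1-morphisms are the
permutations of `Fin n` (with composition the multiplication of the symmetric group and
identity 1-morphism the identity permutation), whose 2-morphisms from `π` to `σ` are the
propagating setoids `r` on `Fin n ⊕ Fin n` with `G π ≤ r` and `G σ ≤ r`, with vertical
composition given by the join of setoids, identity 2-morphism on `π` given by `G π`, and
horizontal composition given by the partition product of setoids. -/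
theorem exists_strict_two_category_Bn (n : ℕ) :
    IsStrictTwoCategoryWithOneObject (Equiv.Perm (Fin n)) (· * ·) 1
      (Setoid (Fin n ⊕ Fin n))
      (fun π σ r => Propagating r ∧ permSetoid π ≤ r ∧ permSetoid σ ≤ r)
      (fun β α => β ⊔ α)
      (fun π => permSetoid π)
      (fun β α => partitionProd β α) where
  mul_assoc := mul_assoc
  one_mul := one_mul
  mul_one := mul_one
  vcomp_mem hα hβ :=
    ⟨propagating_of_permSetoid_le (le_sup_of_le_right hα.2.1),
      le_sup_of_le_right hα.2.1, le_sup_of_le_left hβ.2.2⟩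
  vcomp_assoc _ _ _ := sup_assoc _ _ _
  id2_mem _ := ⟨propagating_of_permSetoid_le le_rfl, le_rfl, le_rfl⟩
  vcomp_id2 hα := sup_eq_left.2 hα.2.1
  id2_vcomp hα := sup_eq_right.2 hα.2.2
  hcomp_mem hα hβ :=
    ⟨propagating_of_permSetoid_le (permSetoid_mul_le_partitionProd hβ.2.1 hα.2.1),
      permSetoid_mul_le_partitionProd hβ.2.1 hα.2.1,
      permSetoid_mul_le_partitionProd hβ.2.2 hα.2.2⟩
  hcomp_assoc hα hβ hγ := partitionProd_assoc hα.2.1 hβ.2.1 hγ.2.1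
  hcomp_id2_one hα := partitionProd_permSetoid_one hα.2.1
  id2_one_hcomp hα := permSetoid_one_partitionProd hα.2.1
  id2_hcomp_id2 := partitionProd_permSetoid
  interchange hα hβ hγ hδ := partitionProd_sup hδ.2.1 hβ.2.2 hγ.2.1 hα.2.2
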